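/- Let P and P′ be finite semiorders, each on n elements, where P is the lexicographic sum of bricks P₁, …, P_k over the k-chain and P′ is the lexicographic sum of bricks P′₁, …, P′_k over the k-chain. Suppose there is a bijection α of {1,…,k} such that for each i the generation probabilities of P_i and P′_{α(i)} are asymptotically equal: lim_{L→∞} [ (V_{P_i}(L)/L^{|P_i|}) / (V_{P′_{α(i)}}(L)/L^{|P′_{α(i)}|}) ] = 1. Then the generation probabilities of P and P′ are asymptotically equal: lim_{L→∞} V_P(L)/V_{P′}(L) = 1. -/

import Mathlib

open MeasureTheory Set Filter

/-- A unit interval representation of a poset. -/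
def UnitRep {α : Type*} [Preorder α] (f : α → ℝ) : Prop :=
  ∀ x y : α, x < y ↔ f x + 1 < f y

/-- A poset is a semiorder if it admits a unit interval representation. -/
def IsSemiorder (α : Type*) [Preorder α] : Prop :=
  ∃ f : α → ℝ, UnitRep f

/-- A poset is a brick if its ground set cannot be partitioned into two nonempty
parts `A`, `B` with every element of `A` below every element of `B`. -/
def IsBrick (α : Type*) [Preorder α] : Prop :=
  ¬ ∃ A B : Set α, A.Nonempty ∧ B.Nonempty ∧ (∀ x, x ∈ A ∨ x ∈ B) ∧
      (∀ x, ¬ (x ∈ A ∧ x ∈ B)) ∧ ∀ a ∈ A, ∀ b ∈ B, a < b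

/-- `genVol r L` is the volume of the set of tuples `x ∈ [0,L]^α` such that the
relation `i ≺ j ↔ x i + 1 < x j` on the index set is isomorphic to `r`. -/
noncomputable def genVol {α : Type*} [Fintype α] (r : α → α → Prop) (L : ℝ) : ℝ :=
  (volume {x : α → ℝ | (∀ i, x i ∈ Icc (0:ℝ) L) ∧
      ∃ e : α ≃ α, ∀ a b : α, r a b ↔ x (e a) + 1 < x (e b)}).toReal

section Aux

def labSet {α : Type*} (r : α → α → Prop) (L : ℝ) : Set (α → ℝ) :=
  {x | (∀ i, x i ∈ Icc (0:ℝ) L) ∧ ∀ a b : α, r a b ↔ x a + 1 < x b}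

def genSet {α : Type*} (r : α → α → Prop) (L : ℝ) : Set (α → ℝ) :=
  {x | (∀ i, x i ∈ Icc (0:ℝ) L) ∧ ∃ e : α ≃ α, ∀ a b : α, r a b ↔ x (e a) + 1 < x (e b)}

def repSet {α : Type*} (r : α → α → Prop) : Set (α → ℝ) :=
  {x | ∀ a b : α, r a b ↔ x a + 1 < x b}

abbrev AutR {α : Type*} (r : α → α → Prop) : Type _ :=
  {e : Equiv.Perm α // ∀ a b, r a b ↔ r (e a) (e b)}

theorem mp_comp {α β : Type*} [Fintype α] [Fintype β] (φ : α ≃ β) :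
    MeasurePreserving (fun x : β → ℝ => x ∘ φ) volume volume := by
  have hm : Measurable (fun x : β → ℝ => x ∘ φ) :=
    measurable_pi_lambda _ fun a => measurable_pi_apply _
  refine ⟨hm, ?_⟩
  refine (Measure.pi_eq fun s hs => ?_).symm
  rw [Measure.map_apply hm (MeasurableSet.univ_pi hs)]
  have : (fun x : β → ℝ => x ∘ φ) ⁻¹' (univ.pi s) = univ.pi (fun b => s (φ.symm b)) := by
    ext x
    simp only [mem_preimage, mem_univ_pi, Function.comp]
    constructor
    · intro h b; simpa using h (φ.symm b)
    · intro h a; simpa using h (φ a)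
  rw [this, volume_pi_pi]
  exact Fintype.prod_equiv φ.symm _ _ (fun b => rfl)

theorem mp_uncurry {ι : Type*} [Fintype ι] (Q : ι → Type*) [∀ i, Fintype (Q i)] :
    MeasurePreserving (fun (y : ∀ i, Q i → ℝ) (p : Σ i, Q i) => y p.1 p.2) volume volume := by
  have hm : Measurable (fun (y : ∀ i, Q i → ℝ) (p : Σ i, Q i) => y p.1 p.2) :=
    measurable_pi_lambda _ fun a => (measurable_pi_apply a.2).comp (measurable_pi_apply a.1)
  refine ⟨hm, ?_⟩
  refine (Measure.pi_eq fun s hs => ?_).symm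
  rw [Measure.map_apply hm (MeasurableSet.univ_pi hs)]
  have : (fun (y : ∀ i, Q i → ℝ) (p : Σ i, Q i) => y p.1 p.2) ⁻¹' (univ.pi s)
      = univ.pi (fun i => univ.pi (fun j => s ⟨i, j⟩)) := by
    ext x
    simp only [mem_preimage, mem_univ_pi, Sigma.forall]
  rw [this, volume_pi_pi, Fintype.prod_sigma]
  simp only [volume_pi_pi]

theorem measurableSet_rel {α : Type*} [Fintype α] (r : α → α → Prop) :
    MeasurableSet (repSet r) := by
  unfold repSet
  have : {x : α → ℝ | ∀ a b : α, r a b ↔ x a + 1 < x b} =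
    ⋂ a, ⋂ b, {x : α → ℝ | r a b ↔ x a + 1 < x b} := by ext; simp
  rw [this]
  refine MeasurableSet.iInter fun a => MeasurableSet.iInter fun b => ?_
  have h : MeasurableSet {x : α → ℝ | x a + 1 < x b} :=
    measurableSet_lt ((measurable_pi_apply a).add_const 1) (measurable_pi_apply b)
  by_cases hr : r a b
  · simpa [hr] using h
  · have h2 := h.compl
    simp only [hr, false_iff]
    exact h2

theorem labSet_eq {α : Type*} (r : α → α → Prop) (L : ℝ) :
    labSet r L = univ.pi (fun _ => Icc 0 L) ∩ repSet r := by
  ext x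
  simp only [labSet, repSet, mem_inter_iff, mem_univ_pi, mem_ofPred_eq]

theorem measurableSet_lab {α : Type*} [Fintype α] (r : α → α → Prop) (L : ℝ) :
    MeasurableSet (labSet r L) := by
  rw [labSet_eq]
  exact (MeasurableSet.univ_pi fun _ => measurableSet_Icc).inter (measurableSet_rel r)

theorem lab_lt_top {α : Type*} [Fintype α] (r : α → α → Prop) (L : ℝ) :
    volume (labSet r L) ≠ ⊤ := by
  rw [labSet_eq]
  refine ne_top_of_le_ne_top ?_ (measure_mono inter_subset_left)
  exact (isCompact_univ_pi fun _ => isCompact_Icc).measure_lt_top.ne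

theorem comp_mem_lab {α : Type*} (r : α → α → Prop) (L : ℝ) (x : α → ℝ) (e : Equiv.Perm α) :
    x ∘ e ∈ labSet r L ↔ (∀ i, x i ∈ Icc (0:ℝ) L) ∧ ∀ a b, r a b ↔ x (e a) + 1 < x (e b) := by
  unfold labSet
  simp only [mem_ofPred_eq, Function.comp]
  refine and_congr_left fun _ => ⟨fun h i => by simpa using h (e.symm i), fun h i => h _⟩

theorem genSet_eq {α : Type*} (r : α → α → Prop) (L : ℝ) :
    genSet r L = ⋃ e : Equiv.Perm α, (fun x => x ∘ e) ⁻¹' labSet r L := by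
  ext x
  simp only [mem_iUnion, mem_preimage, comp_mem_lab, genSet, mem_ofPred_eq]
  exact exists_and_left.symm

theorem measurableSet_gen {α : Type*} [Fintype α] (r : α → α → Prop) (L : ℝ) :
    MeasurableSet (genSet r L) := by
  rw [genSet_eq]
  exact MeasurableSet.iUnion fun e => (mp_comp e).measurable (measurableSet_lab r L)

open Classical in
theorem lab_gen {α : Type*} [Fintype α] (r : α → α → Prop) (L : ℝ) :
    (Nat.factorial (Fintype.card α) : ℝ) * (volume (labSet r L)).toReal
      = (Nat.card (AutR r)) * genVol r L := by
  have key : ((Nat.factorial (Fintype.card α) : ℕ) : ENNReal) * volume (labSet r L)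
      = (Nat.card (AutR r) : ENNReal) * volume (genSet r L) := by
    have h1 : ∀ e : Equiv.Perm α, ∫⁻ x, ((fun x : α → ℝ => x ∘ e) ⁻¹' labSet r L).indicator 1 x
        = volume (labSet r L) := by
      intro e
      rw [lintegral_indicator_one ((mp_comp e).measurable (measurableSet_lab r L)),
        (mp_comp e).measure_preimage (measurableSet_lab r L).nullMeasurableSet]
    have h2 : ∀ x : α → ℝ, ∑ e : Equiv.Perm α,
        ((fun x : α → ℝ => x ∘ e) ⁻¹' labSet r L).indicator (1 : (α → ℝ) → ENNReal) x
        = (Nat.card (AutR r) : ENNReal) * (genSet r L).indicator 1 x := by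
      intro x
      simp only [indicator_apply, Pi.one_apply, mem_preimage]
      rw [Finset.sum_boole]
      by_cases hx : x ∈ genSet r L
      · simp only [hx, if_true, mul_one, Nat.cast_inj]
        rw [genSet_eq] at hx
        simp only [mem_iUnion, mem_preimage] at hx
        obtain ⟨e0, he0⟩ := hx
        rw [comp_mem_lab] at he0
        have hiff : ∀ e : Equiv.Perm α, x ∘ e ∈ labSet r L ↔
            ∀ a b, r a b ↔ r ((e0⁻¹ * e) a) ((e0⁻¹ * e) b) := by
          intro e
          rw [comp_mem_lab]
          constructor
          · rintro ⟨_, h⟩ a b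
            rw [h a b, he0.2]; simp
          · intro h
            refine ⟨he0.1, fun a b => ?_⟩
            rw [h a b, he0.2]; simp
        rw [Nat.card_eq_fintype_card, Fintype.card_subtype]
        refine Finset.card_bij (fun e _ => e0⁻¹ * e) ?_ ?_ ?_
        · intro e he
          simp only [Finset.mem_filter, Finset.mem_univ, true_and] at he ⊢
          exact (hiff e).1 he
        · intro e _ e' _ h; simpa using h
        · intro e he
          simp only [Finset.mem_filter, Finset.mem_univ, true_and] at he
          refine ⟨e0 * e, ?_, by simp⟩
          simp only [Finset.mem_filter, Finset.mem_univ, true_and]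
          rw [hiff]; simpa using he
      · simp only [hx, if_false, mul_zero]
        rw [Finset.filter_false_of_mem]; · simp
        intro e _ he
        apply hx
        rw [genSet_eq]; exact mem_iUnion.2 ⟨e, he⟩
    calc ((Nat.factorial (Fintype.card α) : ℕ) : ENNReal) * volume (labSet r L)
        = ∑ e : Equiv.Perm α, ∫⁻ x, ((fun x : α → ℝ => x ∘ e) ⁻¹' labSet r L).indicator 1 x := by
          simp only [h1]
          rw [Finset.sum_const, Finset.card_univ, Fintype.card_perm, nsmul_eq_mul]
      _ = ∫⁻ x, ∑ e : Equiv.Perm α, ((fun x : α → ℝ => x ∘ e) ⁻¹' labSet r L).indicator 1 x := by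
          rw [lintegral_finsetSum]
          intro e _
          exact measurable_one.indicator ((mp_comp e).measurable (measurableSet_lab r L))
      _ = _ := by
          simp only [h2]
          rw [lintegral_const_mul _ (measurable_one.indicator (measurableSet_gen r L)),
            lintegral_indicator_one (measurableSet_gen r L)]
  have := congrArg ENNReal.toReal key
  simpa [ENNReal.toReal_mul, genVol, genSet] using this

theorem genVol_congr {α β : Type*} [Fintype α] [Fintype β] (φ : α ≃ β) (r : α → α → Prop)
    (r' : β → β → Prop) (h : ∀ a b, r a b ↔ r' (φ a) (φ b)) (L : ℝ) :
    genVol r L = genVol r' L := by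
  change (volume (genSet r L)).toReal = (volume (genSet r' L)).toReal
  rw [← (mp_comp φ).measure_preimage (measurableSet_gen r L).nullMeasurableSet]
  congr 2
  ext x
  simp only [genSet, mem_preimage, mem_ofPred_eq, Function.comp]
  refine and_congr ⟨fun h i => by simpa using h (φ.symm i), fun h i => h _⟩ ?_
  constructor
  · rintro ⟨e, he⟩
    refine ⟨φ.symm.trans (e.trans φ), fun a b => ?_⟩
    have := he (φ.symm a) (φ.symm b)
    rw [h] at this
    simpa using this
  · rintro ⟨e, he⟩
    refine ⟨φ.trans (e.trans φ.symm), fun a b => ?_⟩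
    rw [h, he]; simp

abbrev lexR {ι : Type*} [LT ι] (Q : ι → Type*) [∀ i, LT (Q i)] : (Σ i, Q i) → (Σ i, Q i) → Prop :=
  Sigma.Lex (· < ·) (fun _ => (· < ·))

theorem aut_fst_le {ι : Type*} [LinearOrder ι] (Q : ι → Type*) [∀ i, PartialOrder (Q i)]
    [Finite (Σ i, Q i)] (e : AutR (lexR Q)) (x : Σ i, Q i) : (e.1 x).1 ≤ x.1 := by
  by_contra hx
  push Not at hx
  set i := (e.1 x).1 with hi
  let A : Set (Σ i, Q i) := {y | y.1 < i}
  have hxA : x ∈ A := hx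
  have hns : ¬ A ⊆ e.1 '' A := by
    intro hs
    have : A = e.1 '' A := Set.eq_of_subset_of_ncard_le hs
      (by rw [Set.ncard_image_of_injective _ e.1.injective]) (Set.toFinite _)
    have h2 : e.1 x ∈ A := by rw [this]; exact ⟨x, hxA, rfl⟩
    exact lt_irrefl _ h2
  obtain ⟨y, hyA, hy⟩ := Set.not_subset.1 hns
  obtain ⟨z, rfl⟩ := e.1.surjective y
  have hz : z ∉ A := fun h => hy ⟨z, h, rfl⟩
  have hxz : x.1 < z.1 := lt_of_lt_of_le hx (not_lt.1 hz)
  have h1 : lexR Q (e.1 x) (e.1 z) := (e.2 _ _).1 (Sigma.lex_iff.2 (Or.inl hxz))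
  have h2 : (e.1 z).1 < (e.1 x).1 := hyA
  rcases Sigma.lex_iff.1 h1 with h | ⟨h, _⟩
  · exact lt_asymm h h2
  · exact h2.ne h.symm

theorem aut_fst {ι : Type*} [LinearOrder ι] (Q : ι → Type*) [∀ i, PartialOrder (Q i)]
    [Finite (Σ i, Q i)] (e : AutR (lexR Q)) (x : Σ i, Q i) : (e.1 x).1 = x.1 := by
  refine le_antisymm (aut_fst_le Q e x) ?_
  have := aut_fst_le Q ⟨e.1.symm, fun a b => by rw [e.2 (e.1.symm a)]; simp⟩ (e.1 x)
  simpa using this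

theorem lexR_same {ι : Type*} [LinearOrder ι] (Q : ι → Type*) [∀ i, PartialOrder (Q i)]
    (i : ι) (a b : Q i) : lexR Q ⟨i, a⟩ ⟨i, b⟩ ↔ a < b := by
  unfold lexR; rw [Sigma.lex_iff]; simp

theorem lexR_ne {ι : Type*} [LinearOrder ι] (Q : ι → Type*) [∀ i, PartialOrder (Q i)]
    {i j : ι} (h : i ≠ j) (a : Q i) (b : Q j) : lexR Q ⟨i, a⟩ ⟨j, b⟩ ↔ i < j := by
  unfold lexR; rw [Sigma.lex_iff]; simp [h]

theorem card_aut_lex {ι : Type*} [Fintype ι] [LinearOrder ι] (Q : ι → Type*)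
    [∀ i, PartialOrder (Q i)] [∀ i, Fintype (Q i)] :
    Nat.card (AutR (lexR Q)) = ∏ i, Nat.card (AutR (fun a b : Q i => a < b)) := by
  rw [← Nat.card_pi]
  symm
  refine Nat.card_congr (Equiv.ofBijective (fun f => ⟨Equiv.sigmaCongrRight fun i => (f i).1, ?_⟩) ⟨?_, ?_⟩)
  · rintro ⟨i, a⟩ ⟨j, b⟩
    by_cases h : i = j
    · subst h
      simp only [Equiv.sigmaCongrRight_apply, lexR_same]
      exact (f i).2 a b
    · simp only [Equiv.sigmaCongrRight_apply, lexR_ne Q h]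
  · intro f g h
    funext i
    ext a
    have h2 := congrArg (fun e : AutR (lexR Q) => e.1 ⟨i, a⟩) h
    simpa using h2
  · intro e
    have hex : ∀ i (a : Q i), ∃ b : Q i, e.1 ⟨i, a⟩ = ⟨i, b⟩ := by
      intro i a
      have h := aut_fst Q e ⟨i, a⟩
      generalize e.1 ⟨i, a⟩ = y at h
      obtain ⟨j, b⟩ := y
      simp only at h
      subst h
      exact ⟨b, rfl⟩
    choose f hf using hex
    have hinj : ∀ i, Function.Injective (f i) := by
      intro i a b hab
      have : e.1 ⟨i, a⟩ = e.1 ⟨i, b⟩ := by rw [hf, hf, hab]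
      simpa using e.1.injective this
    refine ⟨fun i => ⟨Equiv.ofBijective (f i) (Finite.injective_iff_bijective.1 (hinj i)), ?_⟩, ?_⟩
    · intro a b
      simp only [Equiv.ofBijective_apply]
      rw [← lexR_same Q, e.2, hf, hf, lexR_same]
    · apply Subtype.ext
      apply Equiv.ext
      rintro ⟨i, a⟩
      simp [hf]

theorem brick_diam {Q : Type*} [Fintype Q] [PartialOrder Q] (hb : IsBrick Q) (x : Q → ℝ)
    (hx : x ∈ repSet (fun a b : Q => a < b)) (a b : Q) : x a ≤ x b + Fintype.card Q := by
  by_contra hlt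
  push Not at hlt
  have hx' : ∀ a b : Q, a < b ↔ x a + 1 < x b := hx
  have hex : ∀ k : Fin (Fintype.card Q), ∃ c : Q, x b + (k : ℕ) < x c ∧ x c ≤ x b + (k : ℕ) + 1 := by
    intro k
    by_contra hno
    push Not at hno
    apply hb
    have hk : ((k : ℕ) : ℝ) + 1 ≤ Fintype.card Q := by exact_mod_cast k.2
    have hk0 : (0:ℝ) ≤ (k : ℕ) := Nat.cast_nonneg _
    refine ⟨{c | x c ≤ x b + (k : ℕ)}, {c | x b + (k : ℕ) < x c}, ⟨b, ?_⟩, ⟨a, ?_⟩, ?_, ?_, ?_⟩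
    · simp only [mem_ofPred_eq]; linarith
    · simp only [mem_ofPred_eq]; linarith
    · intro c; simp only [mem_ofPred_eq]; exact le_or_gt _ _
    · rintro c ⟨h1, h2⟩; simp only [mem_ofPred_eq] at h1 h2; exact absurd h1 (not_le.2 h2)
    · intro c hc d hd
      rw [hx']
      have h1 := hno d hd
      simp only [mem_ofPred_eq] at hc
      linarith
  choose c hc1 hc2 using hex
  have hinj : Function.Injective c := by
    intro k l hkl
    have h1 := hc1 k
    have h2 := hc2 k
    have h3 := hc1 l
    have h4 := hc2 l
    rw [hkl] at h1 h2
    have h5 : ((k : ℕ) : ℝ) < (l : ℕ) + 1 := by linarith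
    have h6 : ((l : ℕ) : ℝ) < (k : ℕ) + 1 := by linarith
    have h5' : (k : ℕ) < l + 1 := by exact_mod_cast h5
    have h6' : (l : ℕ) < k + 1 := by exact_mod_cast h6
    apply Fin.ext; omega
  have hsurj : Function.Surjective c :=
    ((Fintype.bijective_iff_injective_and_card c).2 ⟨hinj, by simp⟩).2
  obtain ⟨k, hk⟩ := hsurj b
  have h1 := hc1 k
  rw [hk] at h1
  have hk0 : (0:ℝ) ≤ (k : ℕ) := Nat.cast_nonneg _
  linarith

theorem base_measure {Q : Type*} [Fintype Q] [PartialOrder Q] (hb : IsBrick Q) (a0 : Q) :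
    ∃ c : NNReal, ((volume : Measure (Q → ℝ)).restrict (repSet (fun a b : Q => a < b))).map
      (fun x => x a0) = c • (volume : Measure ℝ) := by
  set μ := ((volume : Measure (Q → ℝ)).restrict (repSet (fun a b : Q => a < b))).map
      (fun x => x a0) with hμ
  have hm : Measurable (fun x : Q → ℝ => x a0) := measurable_pi_apply a0
  have hR := measurableSet_rel (fun a b : Q => a < b)
  have happ : ∀ T : Set ℝ, MeasurableSet T → μ T =
      volume ((fun x : Q → ℝ => x a0) ⁻¹' T ∩ repSet (fun a b : Q => a < b)) := by
    intro T hT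
    rw [hμ, Measure.map_apply hm hT, Measure.restrict_apply (hm hT)]
  have : IsFiniteMeasureOnCompacts μ := by
    refine ⟨fun K hK => ?_⟩
    obtain ⟨R, hR'⟩ := hK.isBounded.subset_closedBall 0
    refine lt_of_le_of_lt (measure_mono hR') ?_
    rw [happ _ Metric.isClosed_closedBall.measurableSet]
    refine lt_of_le_of_lt (measure_mono ?_) (isCompact_univ_pi (X := fun _ : Q => ℝ)
      (s := fun _ => Icc (-(R + Fintype.card Q)) (R + Fintype.card Q))
      (fun _ => isCompact_Icc)).measure_lt_top
    rintro x ⟨h1, h2⟩ b -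
    simp only [mem_preimage, Real.closedBall_eq_Icc, mem_Icc] at h1
    have h3 := brick_diam hb x h2 a0 b
    have h4 := brick_diam hb x h2 b a0
    constructor <;> linarith
  have : Measure.IsAddLeftInvariant μ := by
    refine ⟨fun g => ?_⟩
    ext T hT
    rw [Measure.map_apply (measurable_const_add g) hT, happ _ (measurable_const_add g hT),
      happ _ hT]
    rw [← measure_preimage_add volume (fun _ : Q => g)
      ((fun x : Q → ℝ => x a0) ⁻¹' T ∩ repSet (fun a b : Q => a < b))]
    congr 1
    ext x
    simp only [repSet, mem_inter_iff, mem_preimage, mem_ofPred_eq, Pi.add_apply]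
    refine and_congr_right fun _ => forall_congr' fun a => forall_congr' fun b => iff_congr Iff.rfl ?_
    constructor <;> intro h <;> linarith
  exact ⟨_, Measure.isAddLeftInvariant_eq_smul μ volume⟩

theorem base_apply {Q : Type*} [Fintype Q] [PartialOrder Q] (a0 : Q) (c : NNReal)
    (hc : ((volume : Measure (Q → ℝ)).restrict (repSet (fun a b : Q => a < b))).map
      (fun x => x a0) = c • (volume : Measure ℝ)) (T : Set ℝ) (hT : MeasurableSet T) :
    volume ((fun x : Q → ℝ => x a0) ⁻¹' T ∩ repSet (fun a b : Q => a < b)) = c * volume T := by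
  have hm : Measurable (fun x : Q → ℝ => x a0) := measurable_pi_apply a0
  rw [← Measure.restrict_apply (hm hT), ← Measure.map_apply hm hT, hc]
  rfl

theorem prod_vol {ι : Type*} [Fintype ι] (Q : ι → Type*) [∀ i, Fintype (Q i)]
    [∀ i, PartialOrder (Q i)] (a : ∀ i, Q i) (c : ι → NNReal)
    (hc : ∀ i, ((volume : Measure (Q i → ℝ)).restrict (repSet (fun a b : Q i => a < b))).map
      (fun x => x (a i)) = c i • (volume : Measure ℝ)) (T : Set (ι → ℝ)) (hT : MeasurableSet T) :
    volume {y : ∀ i, Q i → ℝ | (fun i => y i (a i)) ∈ T ∧ ∀ i, y i ∈ repSet (fun a b : Q i => a < b)}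
      = (∏ i, (c i : ENNReal)) * volume T := by
  have hm : ∀ i, Measurable (fun x : Q i → ℝ => x (a i)) := fun i => measurable_pi_apply (a i)
  have hM : Measurable (fun (y : ∀ i, Q i → ℝ) i => y i (a i)) :=
    measurable_pi_lambda _ fun i => (hm i).comp (measurable_pi_apply i)
  have hset : {y : ∀ i, Q i → ℝ | (fun i => y i (a i)) ∈ T ∧
      ∀ i, y i ∈ repSet (fun a b : Q i => a < b)} =
      (fun (y : ∀ i, Q i → ℝ) i => y i (a i)) ⁻¹' T ∩
        univ.pi (fun i => repSet (fun a b : Q i => a < b)) := by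
    ext y
    simp only [mem_inter_iff, mem_preimage, mem_univ_pi, mem_ofPred_eq]
  rw [hset, ← Measure.restrict_apply (hM hT), ← Measure.map_apply hM hT]
  have hsf : ∀ i, SigmaFinite (((volume : Measure (Q i → ℝ)).restrict
      (repSet (fun a b : Q i => a < b))).map (fun x => x (a i))) := by
    intro i; rw [hc i]; infer_instance
  rw [volume_pi, Measure.restrict_pi_pi,
    Measure.pi_map_pi (f := fun i (x : Q i → ℝ) => x (a i)) (fun i => (hm i).aemeasurable)]
  have hpi : (Measure.pi fun i => ((volume : Measure (Q i → ℝ)).restrict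
      (repSet (fun a b : Q i => a < b))).map (fun x => x (a i))) =
      (∏ i, (c i : ENNReal)) • (volume : Measure (ι → ℝ)) := by
    refine Measure.pi_eq fun s hs => ?_
    simp only [hc, Measure.smul_apply, volume_pi_pi, smul_eq_mul]
    rw [← Finset.prod_mul_distrib]
    rfl
  rw [hpi]
  rfl

def simp1 (m : ℕ) (L : ℝ) : Set (Fin m → ℝ) := {t | (∀ i, t i ∈ Icc 0 L) ∧ ∀ i j, i < j → t i < t j}

theorem simp1_meas (m : ℕ) (L : ℝ) : MeasurableSet (simp1 m L) := by
  have : simp1 m L = univ.pi (fun _ => Icc 0 L) ∩ ⋂ i, ⋂ j, ⋂ (_ : i < j), {t | t i < t j} := by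
    ext t
    simp only [simp1, mem_inter_iff, mem_univ_pi, mem_ofPred_eq, mem_iInter]
  rw [this]
  refine (MeasurableSet.univ_pi fun _ => measurableSet_Icc).inter ?_
  refine MeasurableSet.iInter fun i => MeasurableSet.iInter fun j => MeasurableSet.iInter fun _ => ?_
  exact measurableSet_lt (measurable_pi_apply i) (measurable_pi_apply j)

theorem simp1_ne_top (m : ℕ) (L : ℝ) : volume (simp1 m L) ≠ ⊤ := by
  refine ne_top_of_le_ne_top (isCompact_univ_pi (X := fun _ : Fin m => ℝ)
      (s := fun _ => Icc 0 L) (fun _ => isCompact_Icc)).measure_lt_top.ne (measure_mono ?_)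
  intro t ht i _
  exact ht.1 i

theorem simp1_ne_zero (m : ℕ) : volume (simp1 m 1) ≠ 0 := by
  have hsub : univ.pi (fun i : Fin m => Ioo ((i : ℕ) / (m : ℝ)) (((i : ℕ) + 1) / (m : ℝ))) ⊆ simp1 m 1 := by
    intro t ht
    simp only [mem_univ_pi, mem_Ioo] at ht
    refine ⟨fun i => ⟨?_, ?_⟩, fun i j hij => ?_⟩
    · exact le_trans (by positivity) (ht i).1.le
    · refine (ht i).2.le.trans ?_
      have h : ((i : ℕ) : ℝ) + 1 ≤ m := by exact_mod_cast i.2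
      exact div_le_one_of_le₀ h (Nat.cast_nonneg _)
    · refine ((ht i).2.trans_le ?_).trans (ht j).1
      have h : ((i : ℕ) : ℝ) + 1 ≤ (j : ℕ) := by exact_mod_cast hij
      gcongr
  intro h0
  have := measure_mono_null hsub h0
  rw [volume_pi_pi] at this
  rw [Finset.prod_eq_zero_iff] at this
  obtain ⟨i, _, hi⟩ := this
  rw [Real.volume_Ioo, ENNReal.ofReal_eq_zero] at hi
  have hm : (0:ℝ) < m := by exact_mod_cast i.pos
  rw [← sub_div, add_sub_cancel_left] at hi
  have : 0 < 1 / (m:ℝ) := by positivity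
  linarith

open Pointwise in
theorem simp1_scale (m : ℕ) (L : ℝ) (hL : 0 < L) :
    (volume (simp1 m L)).toReal = L ^ m * (volume (simp1 m 1)).toReal := by
  have : simp1 m L = L • simp1 m 1 := by
    ext t
    rw [mem_smul_set_iff_inv_smul_mem₀ hL.ne']
    simp only [simp1, mem_ofPred_eq, Pi.smul_apply, smul_eq_mul, mem_Icc]
    refine and_congr (forall_congr' fun i => and_congr ?_ ?_)
      (forall_congr' fun i => forall_congr' fun j => imp_congr_right fun _ => ?_)
    · rw [mul_nonneg_iff_of_pos_left (inv_pos.2 hL)]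
    · rw [inv_mul_le_iff₀ hL, mul_one]
    · exact (mul_lt_mul_iff_right₀ (inv_pos.2 hL)).symm
  rw [this, Measure.addHaar_smul, ENNReal.toReal_mul, ENNReal.toReal_ofReal (abs_nonneg _),
    abs_of_nonneg (by positivity)]
  simp

theorem sandwich_tendsto (m : ℕ) (A C : ℝ) (W : ℝ → ℝ) (h1 : ∀ L, C < L → (L - C) ^ m * A ≤ W L)
    (h2 : ∀ L, 0 < L → W L ≤ L ^ m * A) :
    Tendsto (fun L => W L / L ^ m) atTop (nhds A) := by
  have hlow : Tendsto (fun L : ℝ => (1 - C / L) ^ m * A) atTop (nhds A) := by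
    have h : Tendsto (fun L : ℝ => C / L) atTop (nhds 0) := tendsto_const_nhds.div_atTop tendsto_id
    have := (((tendsto_const_nhds (x := (1:ℝ))).sub h).pow m).mul_const A
    simpa using this
  refine tendsto_of_tendsto_of_tendsto_of_le_of_le' hlow tendsto_const_nhds ?_ ?_
  · filter_upwards [eventually_gt_atTop C, eventually_gt_atTop 0] with L hC h0
    rw [le_div_iff₀ (by positivity)]
    refine le_trans (le_of_eq ?_) (h1 L hC)
    have : L - C = L * (1 - C / L) := by field_simp
    rw [this, mul_pow]; ring
  · filter_upwards [eventually_gt_atTop 0] with L h0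
    rw [div_le_iff₀ (by positivity), mul_comm]
    exact h2 L h0

theorem lab_single {Q : Type*} [Fintype Q] [PartialOrder Q] (hb : IsBrick Q) (a0 : Q) (c : NNReal)
    (hc : ((volume : Measure (Q → ℝ)).restrict (repSet (fun a b : Q => a < b))).map
      (fun x => x a0) = c • (volume : Measure ℝ)) :
    (∀ L, 0 ≤ L → (volume (labSet (fun a b : Q => a < b) L)).toReal ≤ L * c) ∧
    Tendsto (fun L => (volume (labSet (fun a b : Q => a < b) L)).toReal / L) atTop (nhds c) := by
  have hup : ∀ L, 0 ≤ L → (volume (labSet (fun a b : Q => a < b) L)).toReal ≤ L * c := by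
    intro L hL
    have h := base_apply a0 c hc (Icc 0 L) measurableSet_Icc
    have hsub : labSet (fun a b : Q => a < b) L ⊆
        (fun x : Q → ℝ => x a0) ⁻¹' (Icc 0 L) ∩ repSet (fun a b : Q => a < b) :=
      fun x hx => ⟨hx.1 a0, hx.2⟩
    have h2 := measure_mono (μ := volume) hsub
    rw [h] at h2
    have h3 := ENNReal.toReal_mono (by simp [ENNReal.mul_eq_top]) h2
    simpa [ENNReal.toReal_mul, hL, mul_comm] using h3
  refine ⟨hup, ?_⟩
  have := sandwich_tendsto 1 c (2 * Fintype.card Q)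
    (fun L => (volume (labSet (fun a b : Q => a < b) L)).toReal) ?_ ?_
  · simpa using this
  · intro L hL
    have h := base_apply a0 c hc (Icc (Fintype.card Q : ℝ) (L - Fintype.card Q)) measurableSet_Icc
    have hsub : (fun x : Q → ℝ => x a0) ⁻¹' (Icc (Fintype.card Q : ℝ) (L - Fintype.card Q)) ∩
        repSet (fun a b : Q => a < b) ⊆ labSet (fun a b : Q => a < b) L := by
      rintro x ⟨h1, h2⟩
      refine ⟨fun b => ?_, h2⟩
      simp only [mem_preimage, mem_Icc] at h1
      have h3 := brick_diam hb x h2 a0 b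
      have h4 := brick_diam hb x h2 b a0
      constructor <;> linarith
    have h2 := measure_mono (μ := volume) hsub
    rw [h] at h2
    have h3 := ENNReal.toReal_mono (lab_lt_top _ _) h2
    rw [ENNReal.toReal_mul, Real.volume_Icc, ENNReal.toReal_ofReal (by linarith)] at h3
    simp only [ENNReal.coe_toReal] at h3
    calc _ = (c:ℝ) * (L - Fintype.card Q - Fintype.card Q) := by ring
      _ ≤ _ := h3
  · intro L hL
    simpa using hup L hL.le

theorem lab_lex (m : ℕ) (Q : Fin m → Type*) [∀ i, Fintype (Q i)]
    [∀ i, PartialOrder (Q i)] (hb : ∀ i, IsBrick (Q i)) (a : ∀ i, Q i) (c : Fin m → NNReal)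
    (hc : ∀ i, ((volume : Measure (Q i → ℝ)).restrict (repSet (fun a b : Q i => a < b))).map
      (fun x => x (a i)) = c i • (volume : Measure ℝ)) :
    Tendsto (fun L => (volume (labSet (lexR Q) L)).toReal / L ^ m) atTop
      (nhds ((volume (simp1 m 1)).toReal * ∏ i, (c i : ℝ))) := by
  set D : ℝ := ∑ i, (Fintype.card (Q i) : ℝ) with hD
  have hD0 : 0 ≤ D := Finset.sum_nonneg fun i _ => Nat.cast_nonneg _
  have hcard : ∀ i, (Fintype.card (Q i) : ℝ) ≤ D := fun i =>
    Finset.single_le_sum (f := fun i => (Fintype.card (Q i) : ℝ))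
      (fun i _ => Nat.cast_nonneg _) (Finset.mem_univ i)
  have hdiam : ∀ i (x : Q i → ℝ), x ∈ repSet (fun a b : Q i => a < b) → ∀ u v, x u ≤ x v + D :=
    fun i x hx u v => (brick_diam (hb i) x hx u v).trans (by linarith [hcard i])
  have hpre : ∀ L, volume (labSet (lexR Q) L) =
      volume ((fun (y : ∀ i, Q i → ℝ) (p : Σ i, Q i) => y p.1 p.2) ⁻¹' labSet (lexR Q) L) :=
    fun L => ((mp_uncurry Q).measure_preimage (measurableSet_lab _ L).nullMeasurableSet).symm
  apply sandwich_tendsto m _ (2 * D + m * (2 * D + 1))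
  · intro L hL
    set C := 2 * D + m * (2 * D + 1) with hC
    let v : Fin m → ℝ := fun i => -(D + (i : ℕ) * (2 * D + 1))
    have hT : MeasurableSet ((fun t => v + t) ⁻¹' simp1 m (L - C)) :=
      (measurable_const_add v) (simp1_meas m _)
    have h := prod_vol Q a c hc _ hT
    rw [measure_preimage_add] at h
    have hsub : {y : ∀ i, Q i → ℝ | (fun i => y i (a i)) ∈ (fun t => v + t) ⁻¹' simp1 m (L - C) ∧
        ∀ i, y i ∈ repSet (fun a b : Q i => a < b)} ⊆
        ((fun (y : ∀ i, Q i → ℝ) (p : Σ i, Q i) => y p.1 p.2) ⁻¹' labSet (lexR Q) L) := by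
      rintro y ⟨h1, h2⟩
      obtain ⟨h1a, h1b⟩ := h1
      simp only [Pi.add_apply, v, mem_Icc] at h1a h1b
      have hsep : ∀ i j, i < j → ∀ (u : Q i) (w : Q j), y i u + 1 < y j w := by
        intro i j hij u w
        have e1 := hdiam i (y i) (h2 i) u (a i)
        have e2 := hdiam j (y j) (h2 j) (a j) w
        have e3 := h1b i j hij
        have e4 : ((i : ℕ) : ℝ) + 1 ≤ (j : ℕ) := by exact_mod_cast hij
        have e5 : (((i : ℕ) : ℝ) + 1) * (2 * D + 1) ≤ (j : ℕ) * (2 * D + 1) := by gcongr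
        linarith
      refine ⟨?_, ?_⟩
      · rintro ⟨i, u⟩
        have e1 := hdiam i (y i) (h2 i) u (a i)
        have e2 := hdiam i (y i) (h2 i) (a i) u
        have e3 := h1a i
        have e4 : ((i : ℕ) : ℝ) ≤ m := by exact_mod_cast i.2.le
        have e5 : ((i : ℕ) : ℝ) * (2 * D + 1) ≤ m * (2 * D + 1) := by gcongr
        have e6 : 0 ≤ ((i : ℕ) : ℝ) * (2 * D + 1) := by positivity
        simp only [mem_Icc]
        constructor <;> linarith
      · rintro ⟨i, u⟩ ⟨j, w⟩
        rcases lt_trichotomy i j with hij | hij | hij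
        · rw [lexR_ne Q hij.ne]
          exact iff_of_true hij (hsep i j hij u w)
        · subst hij
          rw [lexR_same]
          exact h2 i u w
        · rw [lexR_ne Q hij.ne']
          refine iff_of_false hij.asymm ?_
          have := hsep j i hij w u
          simp only
          linarith
    have h2 := measure_mono (μ := volume) hsub
    rw [h, ← hpre] at h2
    have h3 := ENNReal.toReal_mono (lab_lt_top _ _) h2
    rw [ENNReal.toReal_mul, simp1_scale _ _ (by linarith), ENNReal.toReal_prod] at h3
    simp only [ENNReal.coe_toReal] at h3
    refine le_trans (le_of_eq ?_) h3
    ring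
  · intro L hL
    have h := prod_vol Q a c hc _ (simp1_meas m L)
    have hsub : ((fun (y : ∀ i, Q i → ℝ) (p : Σ i, Q i) => y p.1 p.2) ⁻¹' labSet (lexR Q) L) ⊆
        {y : ∀ i, Q i → ℝ | (fun i => y i (a i)) ∈ simp1 m L ∧
          ∀ i, y i ∈ repSet (fun a b : Q i => a < b)} := by
      rintro y ⟨h1, h2⟩
      refine ⟨⟨fun i => h1 ⟨i, a i⟩, fun i j hij => ?_⟩, fun i u w => ?_⟩
      · have := (h2 ⟨i, a i⟩ ⟨j, a j⟩).1 ((lexR_ne Q hij.ne _ _).2 hij)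
        simp only at this
        linarith
      · exact (lexR_same Q i u w).symm.trans (h2 ⟨i, u⟩ ⟨i, w⟩)
    have h2 := measure_mono (μ := volume) hsub
    rw [h, ← hpre] at h2
    have h3 := ENNReal.toReal_mono (ENNReal.mul_ne_top
      (ENNReal.prod_ne_top fun i _ => ENNReal.coe_ne_top) (simp1_ne_top m L)) h2
    rw [ENNReal.toReal_mul, simp1_scale _ _ hL, ENNReal.toReal_prod] at h3
    simp only [ENNReal.coe_toReal] at h3
    refine h3.trans (le_of_eq ?_)
    ring

theorem aut_pos {α : Type*} [Finite α] (r : α → α → Prop) : (0 : ℝ) < Nat.card (AutR r) := by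
  have : Nonempty (AutR r) := ⟨⟨1, fun a b => Iff.rfl⟩⟩
  exact_mod_cast Nat.card_pos

theorem genVol_eq {α : Type*} [Fintype α] (r : α → α → Prop) (L : ℝ) :
    genVol r L = (Nat.factorial (Fintype.card α) : ℝ) / Nat.card (AutR r) *
      (volume (labSet r L)).toReal := by
  have h := lab_gen r L
  have := (aut_pos r).ne'
  field_simp
  linarith

theorem gen_single_c {Q : Type*} [Fintype Q] [PartialOrder Q] (hb : IsBrick Q) (a0 : Q) (c : NNReal)
    (hc : ((volume : Measure (Q → ℝ)).restrict (repSet (fun a b : Q => a < b))).map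
      (fun x => x a0) = c • (volume : Measure ℝ)) :
    Tendsto (fun L => genVol (fun a b : Q => a < b) L / L) atTop
      (nhds ((Nat.factorial (Fintype.card Q) : ℝ) / Nat.card (AutR (fun a b : Q => a < b)) * c)) := by
  simp only [genVol_eq, mul_div_assoc]
  exact (lab_single hb a0 c hc).2.const_mul _

theorem gen_single {Q : Type*} [Fintype Q] [PartialOrder Q] (hb : IsBrick Q) [Nonempty Q] :
    ∃ v : ℝ, (v = 0 → ∀ L, 0 ≤ L → genVol (fun a b : Q => a < b) L = 0) ∧
      Tendsto (fun L => genVol (fun a b : Q => a < b) L / L) atTop (nhds v) := by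
  obtain ⟨a0⟩ := ‹Nonempty Q›
  obtain ⟨c, hc⟩ := base_measure hb a0
  refine ⟨_, ?_, gen_single_c hb a0 c hc⟩
  intro h0 L hL
  have hpos := aut_pos (fun a b : Q => a < b)
  have hf : (0:ℝ) < (Nat.factorial (Fintype.card Q) : ℝ) := by exact_mod_cast Nat.factorial_pos _
  have hc0 : (c : ℝ) = 0 := by
    rcases mul_eq_zero.1 h0 with h | h
    · exact absurd h (div_pos hf hpos).ne'
    · exact h
  have h1 := (lab_single hb a0 c hc).1 L hL
  rw [hc0, mul_zero] at h1
  rw [genVol_eq, le_antisymm h1 ENNReal.toReal_nonneg, mul_zero]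

theorem gen_lex (m : ℕ) (Q : Fin m → Type*) [∀ i, Fintype (Q i)]
    [∀ i, PartialOrder (Q i)] (hb : ∀ i, IsBrick (Q i)) [∀ i, Nonempty (Q i)] (v : Fin m → ℝ)
    (hv : ∀ i, Tendsto (fun L => genVol (fun a b : Q i => a < b) L / L) atTop (nhds (v i))) :
    Tendsto (fun L => genVol (lexR Q) L / L ^ m) atTop
      (nhds ((Nat.factorial (∑ i, Fintype.card (Q i)) : ℝ) * (volume (simp1 m 1)).toReal *
        ∏ i, v i / (Nat.factorial (Fintype.card (Q i)) : ℝ))) := by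
  have a : ∀ i, Q i := fun i => Classical.arbitrary _
  choose c hc using fun i => base_measure (hb i) (a i)
  have hl := (lab_lex m Q hb a c hc).const_mul
    ((Nat.factorial (Fintype.card (Σ i, Q i)) : ℝ) / Nat.card (AutR (lexR Q)))
  simp only [genVol_eq, mul_div_assoc] at hl ⊢
  convert hl using 2
  rw [Fintype.card_sigma, card_aut_lex, Nat.cast_prod]
  have hvc : ∀ i, v i / (Nat.factorial (Fintype.card (Q i)) : ℝ) =
      c i / Nat.card (AutR (fun a b : Q i => a < b)) := by
    intro i
    have := tendsto_nhds_unique (hv i) (gen_single_c (hb i) (a i) (c i) (hc i))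
    rw [this]
    have hf : (Nat.factorial (Fintype.card (Q i)) : ℝ) ≠ 0 := by exact_mod_cast Nat.factorial_ne_zero _
    field_simp
  simp only [hvc, Finset.prod_div_distrib]
  ring

theorem gen_term {Q : Type*} [Fintype Q] [PartialOrder Q] (hb : IsBrick Q) :
    ∃ v : ℝ, (v = 0 → ∀ L, 0 ≤ L → genVol (fun a b : Q => a < b) L = 0) ∧
      Tendsto (fun L => genVol (fun a b : Q => a < b) L / L ^ Fintype.card Q *
        L ^ (Fintype.card Q - 1)) atTop (nhds v) ∧
      (0 < Fintype.card Q → Tendsto (fun L => genVol (fun a b : Q => a < b) L / L) atTop (nhds v)) ∧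
      (Fintype.card Q ≤ 1 → v = 1) := by
  rcases isEmpty_or_nonempty Q with hE | hN
  · have hc : Fintype.card Q = 0 := Fintype.card_eq_zero
    have hg : ∀ L, genVol (fun a b : Q => a < b) L = 1 := by
      intro L
      unfold genVol
      have : {x : Q → ℝ | (∀ i, x i ∈ Icc (0:ℝ) L) ∧
          ∃ e : Q ≃ Q, ∀ a b : Q, a < b ↔ x (e a) + 1 < x (e b)} = univ.pi (fun _ => univ) := by
        ext x
        simp only [mem_ofPred_eq, mem_univ_pi, mem_univ, implies_true, iff_true]
        exact ⟨fun i => isEmptyElim i, Equiv.refl _, fun a => isEmptyElim a⟩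
      rw [this, volume_pi_pi]
      simp
    refine ⟨1, by simp, ?_, by omega, fun _ => rfl⟩
    simp [hg]
  · obtain ⟨v, h1, h2⟩ := gen_single hb
    refine ⟨v, h1, ?_, fun _ => h2, ?_⟩
    · refine h2.congr' ?_
      filter_upwards [eventually_gt_atTop 0] with L hL
      obtain ⟨d, hd⟩ : ∃ d, Fintype.card Q = d + 1 :=
        ⟨Fintype.card Q - 1, (Nat.succ_pred_eq_of_pos Fintype.card_pos).symm⟩
      rw [hd, Nat.add_sub_cancel, pow_succ]
      field_simp
    · intro hle
      have hsub : Subsingleton Q := Fintype.card_le_one_iff_subsingleton.1 hle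
      have hc : Fintype.card Q = 1 := le_antisymm hle Fintype.card_pos
      refine tendsto_nhds_unique h2 (tendsto_const_nhds.congr' ?_)
      filter_upwards [eventually_gt_atTop 0] with L hL
      have hg : genVol (fun a b : Q => a < b) L = L := by
        unfold genVol
        have : {x : Q → ℝ | (∀ i, x i ∈ Icc (0:ℝ) L) ∧
            ∃ e : Q ≃ Q, ∀ a b : Q, a < b ↔ x (e a) + 1 < x (e b)} =
            univ.pi (fun _ => Icc 0 L) := by
          ext x
          simp only [mem_ofPred_eq, mem_univ_pi, and_iff_left_iff_imp]
          intro _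
          refine ⟨Equiv.refl _, fun a b => ?_⟩
          obtain rfl := Subsingleton.elim a b
          simp
        rw [this, volume_pi_pi]
        simp [hc, hL.le]
      rw [hg, div_self hL.ne']

theorem cmp_aux (F G : ℝ → ℝ) (d d' : ℕ) (v v' : ℝ) (hv : v ≠ 0) (hv' : v' ≠ 0)
    (h : Tendsto (fun L => F L * L ^ d) atTop (nhds v))
    (h' : Tendsto (fun L => G L * L ^ d') atTop (nhds v'))
    (hr : Tendsto (fun L => F L / G L) atTop (nhds 1)) : ¬ d < d' := by
  intro hlt
  obtain ⟨e, rfl⟩ := Nat.exists_eq_add_of_lt hlt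
  have hq := h.div h' hv'
  have h0 : Tendsto (fun L : ℝ => F L / G L * (L ^ (e + 1))⁻¹) atTop (nhds (1 * 0)) :=
    hr.mul (tendsto_pow_atTop (by omega)).inv_tendsto_atTop
  rw [mul_zero] at h0
  have : v / v' = 0 := by
    refine tendsto_nhds_unique hq (h0.congr' ?_)
    filter_upwards [eventually_gt_atTop 0] with L hL
    simp only [Pi.div_apply]
    rw [show d + e + 1 = d + (e + 1) by ring, pow_add]
    field_simp
    try ring
  exact (div_ne_zero hv hv') this

theorem cmp_lim (F G : ℝ → ℝ) (d d' : ℕ) (v v' : ℝ) (hv : v ≠ 0) (hv' : v' ≠ 0)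
    (h : Tendsto (fun L => F L * L ^ d) atTop (nhds v))
    (h' : Tendsto (fun L => G L * L ^ d') atTop (nhds v'))
    (hr : Tendsto (fun L => F L / G L) atTop (nhds 1)) : d = d' ∧ v = v' := by
  have h1 := cmp_aux F G d d' v v' hv hv' h h' hr
  have h2 := cmp_aux G F d' d v' v hv' hv h' h (by
    have := hr.inv₀ one_ne_zero
    simpa using this)
  have hd : d = d' := by omega
  refine ⟨hd, ?_⟩
  subst hd
  have hq := h.div h' hv'
  have : v / v' = 1 := by
    refine tendsto_nhds_unique hq (hr.congr' ?_)
    filter_upwards [eventually_gt_atTop 0] with L hL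
    simp only [Pi.div_apply]
    field_simp
  field_simp at this
  exact this

theorem lex_reduce (k : ℕ) (P : Fin k → Type) [∀ i, Fintype (P i)] [∀ i, PartialOrder (P i)]
    (hb : ∀ i, IsBrick (P i)) (v : Fin k → ℝ)
    (hv : ∀ i, 0 < Fintype.card (P i) →
      Tendsto (fun L => genVol (fun a b : P i => a < b) L / L) atTop (nhds (v i)))
    (hv1 : ∀ i, Fintype.card (P i) ≤ 1 → v i = 1) (m : ℕ)
    (hm : (Finset.univ.filter fun i => 0 < Fintype.card (P i)).card = m) :
    Tendsto (fun L => genVol (fun a b : Σₗ i, P i => a < b) L / L ^ m) atTop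
      (nhds ((Nat.factorial (∑ i, Fintype.card (P i)) : ℝ) * (volume (simp1 m 1)).toReal *
        ∏ i, v i / (Nat.factorial (Fintype.card (P i)) : ℝ))) := by
  set s := Finset.univ.filter fun i => 0 < Fintype.card (P i) with hs
  let φ := s.orderIsoOfFin hm
  have hpos : ∀ i : s, 0 < Fintype.card (P i) := fun i => (Finset.mem_filter.1 i.2).2
  let Q : Fin m → Type := fun j => P (φ j)
  have hne : ∀ j, Nonempty (Q j) := fun j => Fintype.card_pos_iff.1 (hpos (φ j))
  let _ : ∀ j, Fintype (Q j) := fun j => inferInstanceAs (Fintype (P (φ j)))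
  let _ : ∀ j, PartialOrder (Q j) := fun j => inferInstanceAs (PartialOrder (P (φ j)))
  have hlim := gen_lex m Q (fun j => hb (φ j)) (fun j => v (φ j)) (fun j => hv (φ j) (hpos _))
  have hsum : ∑ j, Fintype.card (Q j) = ∑ i, Fintype.card (P i) := by
    calc ∑ j, Fintype.card (P (φ j)) = ∑ i : s, Fintype.card (P i) :=
          Equiv.sum_comp φ.toEquiv (fun i : s => Fintype.card (P i))
      _ = ∑ i ∈ s, Fintype.card (P i) := Finset.sum_coe_sort s (fun i => Fintype.card (P i))
      _ = _ := Finset.sum_subset (Finset.subset_univ _) (by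
          intro i _ hi
          simp only [hs, Finset.mem_filter, Finset.mem_univ, true_and] at hi
          omega)
  have hprod : ∏ j, v (φ j) / (Nat.factorial (Fintype.card (Q j)) : ℝ) =
      ∏ i, v i / (Nat.factorial (Fintype.card (P i)) : ℝ) := by
    calc ∏ j, v (φ j) / (Nat.factorial (Fintype.card (P (φ j))) : ℝ)
        = ∏ i : s, v i / (Nat.factorial (Fintype.card (P i)) : ℝ) :=
          Equiv.prod_comp φ.toEquiv (fun i : s => v i / (Nat.factorial (Fintype.card (P i)) : ℝ))
      _ = ∏ i ∈ s, v i / (Nat.factorial (Fintype.card (P i)) : ℝ) :=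
          Finset.prod_coe_sort s (fun i => v i / (Nat.factorial (Fintype.card (P i)) : ℝ))
      _ = _ := Finset.prod_subset (Finset.subset_univ _) (by
          intro i _ hi
          simp only [hs, Finset.mem_filter, Finset.mem_univ, true_and] at hi
          have h0 : Fintype.card (P i) = 0 := by omega
          rw [hv1 i (by omega), h0]; simp)
  rw [hsum, hprod] at hlim
  refine hlim.congr fun L => ?_
  congr 1
  let f : (Σ j, Q j) → (Σₗ i, P i) := fun p => toLex ⟨φ p.1, p.2⟩
  have hf : Function.Bijective f := by
    constructor
    · rintro ⟨i, a⟩ ⟨j, b⟩ h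
      have h' : (⟨φ i, a⟩ : Σ i, P i) = ⟨φ j, b⟩ := h
      have hij : i = j := φ.injective (Subtype.ext (congrArg Sigma.fst h'))
      subst hij
      simpa using h'
    · intro y
      obtain ⟨i, a⟩ := y
      have hi : i ∈ s := Finset.mem_filter.2 ⟨Finset.mem_univ _, Fintype.card_pos_iff.2 ⟨a⟩⟩
      obtain ⟨j, hj⟩ := φ.surjective ⟨i, hi⟩
      have hj' : (φ j : Fin k) = i := congrArg Subtype.val hj
      subst hj'
      exact ⟨⟨j, a⟩, rfl⟩
  refine genVol_congr (Equiv.ofBijective f hf) _ _ ?_ L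
  rintro ⟨i, a⟩ ⟨j, b⟩
  change lexR Q ⟨i, a⟩ ⟨j, b⟩ ↔ lexR P ⟨φ i, a⟩ ⟨φ j, b⟩
  by_cases hij : i = j
  · subst hij
    rw [lexR_same, lexR_same]
  · have hne : (φ i : Fin k) ≠ φ j := fun h => hij (φ.injective (Subtype.ext h))
    rw [lexR_ne Q hij, lexR_ne P hne]
    exact (φ.lt_iff_lt (x := i) (y := j)).symm

end Aux

/-- If two lexicographic sums of bricks over the `k`-chain, on the same number of
elements, have termwise asymptotically equal generation probabilities (up to a
permutation of the terms), then their generation probabilities are asymptotically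
equal. -/
theorem lex_sums_asymptotically_equal (k : ℕ) (hk : 1 ≤ k) (n : ℕ)
    (P P' : Fin k → Type)
    [∀ i, Fintype (P i)] [∀ i, PartialOrder (P i)]
    [∀ i, Fintype (P' i)] [∀ i, PartialOrder (P' i)]
    (hsem : ∀ i, IsSemiorder (P i)) (hbrick : ∀ i, IsBrick (P i))
    (hsem' : ∀ i, IsSemiorder (P' i)) (hbrick' : ∀ i, IsBrick (P' i))
    (hn : ∑ i, Fintype.card (P i) = n) (hn' : ∑ i, Fintype.card (P' i) = n)
    (σ : Equiv.Perm (Fin k))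
    (hratio : ∀ i, Tendsto (fun L : ℝ =>
        (genVol (fun a b : P i => a < b) L / L ^ (Fintype.card (P i))) /
          (genVol (fun a b : P' (σ i) => a < b) L / L ^ (Fintype.card (P' (σ i)))))
      atTop (nhds 1)) :
    Tendsto (fun L : ℝ =>
        genVol (fun a b : Σₗ i, P i => a < b) L /
          genVol (fun a b : Σₗ i, P' i => a < b) L) atTop (nhds 1) := by
  choose v hv0 hvlim hvpos hv1 using fun i => gen_term (hbrick i)
  choose v' hv0' hvlim' hvpos' hv1' using fun i => gen_term (hbrick' i)
  have hex : ∀ i, ∃ L : ℝ, 0 ≤ L ∧ genVol (fun a b : P i => a < b) L ≠ 0 ∧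
      genVol (fun a b : P' (σ i) => a < b) L ≠ 0 := by
    intro i
    have h1 := (hratio i).eventually_ne one_ne_zero
    obtain ⟨L, hL, hL0⟩ := (h1.and (eventually_ge_atTop 0)).exists
    refine ⟨L, hL0, fun h => hL ?_, fun h => hL ?_⟩ <;> simp [h]
  have hvne : ∀ i, v i ≠ 0 := fun i h => by
    obtain ⟨L, h0, h1, _⟩ := hex i
    exact h1 (hv0 i h L h0)
  have hvne' : ∀ i, v' (σ i) ≠ 0 := fun i h => by
    obtain ⟨L, h0, _, h1⟩ := hex i
    exact h1 (hv0' (σ i) h L h0)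
  have hcmp := fun i => cmp_lim _ _ _ _ _ _ (hvne i) (hvne' i) (hvlim i) (hvlim' (σ i)) (hratio i)
  have hprod : ∏ i, v i / (Nat.factorial (Fintype.card (P i)) : ℝ) =
      ∏ i, v' i / (Nat.factorial (Fintype.card (P' i)) : ℝ) := by
    rw [← Equiv.prod_comp σ (fun i => v' i / (Nat.factorial (Fintype.card (P' i)) : ℝ))]
    refine Finset.prod_congr rfl fun i _ => ?_
    obtain ⟨h1, h2⟩ := hcmp i
    rw [h2]
    congr 2
    by_cases h : Fintype.card (P i) ≤ 1
    · rw [Nat.factorial_eq_one.2 h, Nat.factorial_eq_one.2 (by omega)]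
    · congr 1
      omega
  have hm : ∀ (R : Fin k → ℕ), (Finset.univ.filter fun i => 0 < R i).card + ∑ i, (R i - 1)
      = ∑ i, R i := by
    intro R
    rw [Finset.card_filter, ← Finset.sum_add_distrib]
    refine Finset.sum_congr rfl fun i _ => ?_
    split_ifs <;> omega
  have hd : ∑ i, (Fintype.card (P i) - 1) = ∑ i, (Fintype.card (P' i) - 1) := by
    rw [← Equiv.sum_comp σ (fun i => Fintype.card (P' i) - 1)]
    exact Finset.sum_congr rfl fun i _ => (hcmp i).1
  have e1 := hm (fun i => Fintype.card (P i))
  have e2 := hm (fun i => Fintype.card (P' i))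
  have A := lex_reduce k P hbrick v hvpos hv1 _ rfl
  have B := lex_reduce k P' hbrick' v' hvpos' hv1'
    (Finset.univ.filter fun i => 0 < Fintype.card (P i)).card (by omega)
  set m := (Finset.univ.filter fun i => 0 < Fintype.card (P i)).card
  rw [hn, hprod] at A
  rw [hn'] at B
  have hne : (Nat.factorial n : ℝ) * (volume (simp1 m 1)).toReal *
      ∏ i, v' i / (Nat.factorial (Fintype.card (P' i)) : ℝ) ≠ 0 := by
    refine mul_ne_zero (mul_ne_zero ?_ ?_) (Finset.prod_ne_zero_iff.2 fun i _ => div_ne_zero ?_ ?_)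
    · exact_mod_cast Nat.factorial_ne_zero _
    · exact (ENNReal.toReal_pos (simp1_ne_zero m) (simp1_ne_top m 1)).ne'
    · simpa using hvne' (σ.symm i)
    · exact_mod_cast Nat.factorial_ne_zero _
  have hdiv := A.div B hne
  rw [div_self hne] at hdiv
  refine hdiv.congr' ?_
  filter_upwards [eventually_gt_atTop 0] with L hL
  simp only [Pi.div_apply]
  exact div_div_div_cancel_right₀ (pow_ne_zero _ hL.ne') _ _
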